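/- arXiv:2109.06911 — 2 statements merged into one kernel-verified Lean document; each statement's English description precedes it below -/
import Mathlib

section
/- Let (a_T) be a sequence of positive reals with a_T → ∞ and a_T/T → 0. If a regular predictor ĉ ∈ 𝒞 satisfies the out-of-sample guarantee, then for all x ∈ 𝒳 and all P ∈ 𝒫°: liminf_{T→∞} √(T/a_T)·(ĉ(x,P,T) − c(x,P)) ≥ limsup_{T→∞} √(T/a_T)·|ĉ_V(x,P,T) − c(x,P)| = √(2·Var_P(ℓ(x,ξ))). -/
open Filter Asymptotics

namespace DDO

/-- The probability simplex `𝒫` over the scenario set `Σ = Fin d`. -/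
def simplex (d : ℕ) : Set (Fin d → ℝ) :=
  {P | (∀ i, 0 ≤ P i) ∧ ∑ i, P i = 1}

/-- The relative interior `𝒫°` of the probability simplex. -/
def simplexInt (d : ℕ) : Set (Fin d → ℝ) :=
  {P | (∀ i, 0 < P i) ∧ ∑ i, P i = 1}

/-- Expected cost `c(x, P) = ∑ i, ℓ(x, i) · P(i)` (extended linearly to `ℝ^d`). -/
noncomputable def cost {X : Type*} {d : ℕ} (ℓ : X → Fin d → ℝ) (x : X)
    (P : Fin d → ℝ) : ℝ :=
  ∑ i, ℓ x i * P i

/-- Variance `Var_P(ℓ(x, ξ))` of the loss under `P`. -/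
noncomputable def varLoss {X : Type*} {d : ℕ} (ℓ : X → Fin d → ℝ) (x : X)
    (P : Fin d → ℝ) : ℝ :=
  (∑ i, ℓ x i ^ 2 * P i) - cost ℓ x P ^ 2

/-- Empirical distribution `P̂_T` of the `T` samples `ω`. -/
noncomputable def empDist {d T : ℕ} (ω : Fin T → Fin d) : Fin d → ℝ :=
  fun i => ((Finset.univ.filter (fun t => ω t = i)).card : ℝ) / (T : ℝ)

open Classical in
/-- `ℙ^∞(A)`: the probability, under i.i.d. sampling from `P`, of an event `A`
depending on the first `T` samples. -/
noncomputable def probT {d : ℕ} (P : Fin d → ℝ) (T : ℕ)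
    (A : (Fin T → Fin d) → Prop) : ℝ :=
  ∑ ω : Fin T → Fin d, if A ω then ∏ t, P (ω t) else 0

/-- Regular predictors (the class `𝒞`): uniformly bounded, equicontinuous,
differentiable in the distribution argument (in the Fréchet sense along the simplex),
with uniformly bounded and equicontinuous derivatives. -/
structure IsRegularPredictor {X : Type*} [MetricSpace X] (d : ℕ)
    (chat : X → (Fin d → ℝ) → ℕ → ℝ) : Prop where
  unifBounded : ∃ K : ℝ, ∀ (T : ℕ) (x : X), ∀ P ∈ simplex d, |chat x P T| ≤ K
  equicontinuous : ∀ (x : X), ∀ P ∈ simplex d, ∀ ε > (0 : ℝ), ∃ δ > (0 : ℝ),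
    ∀ (T : ℕ) (x' : X), ∀ P' ∈ simplex d,
      dist x x' < δ → dist P P' < δ → |chat x P T - chat x' P' T| < ε
  differentiableDeriv : ∃ D : X → (Fin d → ℝ) → ℕ → ((Fin d → ℝ) →L[ℝ] ℝ),
    (∀ (T : ℕ) (x : X), ∀ P ∈ simplex d,
      HasFDerivWithinAt (fun Q => chat x Q T) (D x P T) (simplex d) P) ∧
    (∃ K : ℝ, ∀ (T : ℕ) (x : X), ∀ P ∈ simplex d, ‖D x P T‖ ≤ K) ∧
    (∀ (x : X), ∀ P ∈ simplex d, ∀ ε > (0 : ℝ), ∃ δ > (0 : ℝ),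
      ∀ (T : ℕ) (x' : X), ∀ P' ∈ simplex d,
        dist x x' < δ → dist P P' < δ → ‖D x P T - D x' P' T‖ < ε)

/-- The out-of-sample guarantee at speed `(a_T)`:
`limsup_{T→∞} (1/a_T) · log ℙ^∞( c(x,P) > ĉ(x, P̂_T, T) ) ≤ -1`
for every `x ∈ 𝒳` and `P ∈ 𝒫°`, stated in the equivalent ε-eventual form
`ℙ^∞(disappointment) ≤ exp((-1+ε) a_T)` eventually (which in particular permits a
disappointment probability equal to zero). -/
def OOSGuarantee {X : Type*} {d : ℕ} (ℓ : X → Fin d → ℝ) (a : ℕ → ℝ)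
    (chat : X → (Fin d → ℝ) → ℕ → ℝ) : Prop :=
  ∀ (x : X), ∀ P ∈ simplexInt d, ∀ ε > (0 : ℝ), ∀ᶠ T : ℕ in atTop,
    probT P T (fun ω => cost ℓ x P > chat x (empDist ω) T) ≤
      Real.exp ((-1 + ε) * a T)

/-- The prediction error `|ĉ(x,P,T) - c(x,P)|`. -/
noncomputable def predErr {X : Type*} {d : ℕ} (ℓ : X → Fin d → ℝ)
    (chat : X → (Fin d → ℝ) → ℕ → ℝ) (x : X) (P : Fin d → ℝ) (T : ℕ) : ℝ :=
  |chat x P T - cost ℓ x P|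

open Classical in
/-- Ratio with the convention `0 / 0 = 1`. -/
noncomputable def ratio (u v : ℝ) : ℝ := if u = 0 ∧ v = 0 then 1 else u / v

/-- The partial order `⪯_𝒞` on predictors:
`limsup_{T→∞} |ĉ₁(x,P,T) - c(x,P)| / |ĉ₂(x,P,T) - c(x,P)| ≤ 1`
(convention `0/0 = 1`) for every `x ∈ 𝒳`, `P ∈ 𝒫°`, stated in the equivalent
ε-eventual form (the ratio is a nonnegative sequence). -/
def PredOrder {X : Type*} {d : ℕ} (ℓ : X → Fin d → ℝ)
    (chat1 chat2 : X → (Fin d → ℝ) → ℕ → ℝ) : Prop :=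
  ∀ (x : X), ∀ P ∈ simplexInt d, ∀ ε > (0 : ℝ), ∀ᶠ T : ℕ in atTop,
    ratio (predErr ℓ chat1 x P T) (predErr ℓ chat2 x P T) ≤ 1 + ε

/-- The equivalence `≡` on predictors: `|ĉ₁ - c|` and `|ĉ₂ - c|` are asymptotically
equivalent as `T → ∞` for every `x ∈ 𝒳` and `P ∈ 𝒫°`. -/
def PredEquiv {X : Type*} {d : ℕ} (ℓ : X → Fin d → ℝ)
    (chat1 chat2 : X → (Fin d → ℝ) → ℕ → ℝ) : Prop :=
  ∀ (x : X), ∀ P ∈ simplexInt d,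
    (fun T : ℕ => predErr ℓ chat1 x P T) ~[atTop]
      (fun T : ℕ => predErr ℓ chat2 x P T)

/-- A single term `q · log(q/p)` of the relative entropy, with the conventions
`0 · log(0/p) = 0` and `q · log(q/0) = ∞` for `q > 0`. -/
noncomputable def klTerm (q p : ℝ) : EReal :=
  if q = 0 then 0 else if p = 0 then ⊤ else ((q * Real.log (q / p) : ℝ) : EReal)

/-- The relative entropy (KL divergence) `I(Q, P')`. -/
noncomputable def relEnt {d : ℕ} (Q P' : Fin d → ℝ) : EReal :=
  ∑ i, klTerm (Q i) (P' i)

/-- The KL-DRO predictor with radius `r`: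
`ĉ_KL(x,P) = sup { c(x,P') : P' ∈ 𝒫, I(P,P') ≤ r }`. -/
noncomputable def cKL {X : Type*} {d : ℕ} (ℓ : X → Fin d → ℝ) (r : ℝ)
    (x : X) (P : Fin d → ℝ) : ℝ :=
  sSup {y | ∃ P' ∈ simplex d, relEnt P P' ≤ (r : EReal) ∧ y = cost ℓ x P'}

/-- The robust predictor `ĉ_R(x) = max_{i ∈ Σ} ℓ(x,i)`. -/
noncomputable def cR {X : Type*} {d : ℕ} (ℓ : X → Fin d → ℝ) (x : X) : ℝ :=
  ⨆ i : Fin d, ℓ x i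

/-- The sample variance penalization (SVP) predictor
`ĉ_V(x,P,T) = c(x,P) + √((2 a_T / T) · Var_P(ℓ(x,ξ)))`. -/
noncomputable def cV {X : Type*} {d : ℕ} (a : ℕ → ℝ) (ℓ : X → Fin d → ℝ)
    (x : X) (P : Fin d → ℝ) (T : ℕ) : ℝ :=
  cost ℓ x P + Real.sqrt ((2 * a T / (T : ℝ)) * varLoss ℓ x P)

/-- The squared local ellipsoid norm `‖Δ‖_P² = (1/2) ∑ i, Δ_i² / P(i)`. -/
noncomputable def ellNormSq {d : ℕ} (P Δ : Fin d → ℝ) : ℝ :=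
  (1 / 2) * ∑ i, Δ i ^ 2 / P i

/-- The optimal cost `c*(P) = min_{x ∈ 𝒳} c(x,P)`. -/
noncomputable def cstar {X : Type*} {d : ℕ} (ℓ : X → Fin d → ℝ)
    (P : Fin d → ℝ) : ℝ :=
  sInf (Set.range fun x : X => cost ℓ x P)

/-- The optimal predicted cost `ĉ*(P,T) = min_{x ∈ 𝒳} ĉ(x,P,T)`. -/
noncomputable def chatStar {X : Type*} {d : ℕ} (chat : X → (Fin d → ℝ) → ℕ → ℝ)
    (P : Fin d → ℝ) (T : ℕ) : ℝ :=
  sInf (Set.range fun x : X => chat x P T)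

/-- `x̂` is a prescriptor associated with the predictor `ĉ`:
`x̂_T(P) ∈ argmin_{x ∈ 𝒳} ĉ(x,P,T)` for all `P ∈ 𝒫` and `T`. -/
def IsPrescriptor {X : Type*} {d : ℕ} (chat : X → (Fin d → ℝ) → ℕ → ℝ)
    (xhat : ℕ → (Fin d → ℝ) → X) : Prop :=
  ∀ (T : ℕ), ∀ P ∈ simplex d, ∀ x : X, chat (xhat T P) P T ≤ chat x P T

/-- The prescription out-of-sample guarantee at speed `(a_T)`:
`limsup_{T→∞} (1/a_T) · log ℙ^∞( c(x̂_T(P̂_T), P) > ĉ*(P̂_T, T) ) ≤ -1`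
for every `P ∈ 𝒫°`, stated in the equivalent ε-eventual form. -/
def PrescOOSGuarantee {X : Type*} {d : ℕ} (ℓ : X → Fin d → ℝ) (a : ℕ → ℝ)
    (chat : X → (Fin d → ℝ) → ℕ → ℝ) (xhat : ℕ → (Fin d → ℝ) → X) : Prop :=
  ∀ P ∈ simplexInt d, ∀ ε > (0 : ℝ), ∀ᶠ T : ℕ in atTop,
    probT P T (fun ω =>
        cost ℓ (xhat T (empDist ω)) P > chatStar chat (empDist ω) T) ≤
      Real.exp ((-1 + ε) * a T)

/-- The partial order `⪯_X̂` on prescriptors: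
`limsup_{T→∞} |ĉ₁*(P,T) - c*(P)| / |ĉ₂*(P,T) - c*(P)| ≤ 1` (convention `0/0 = 1`)
for every `P ∈ 𝒫°`, stated in the equivalent ε-eventual form. -/
def PrescOrder {X : Type*} {d : ℕ} (ℓ : X → Fin d → ℝ)
    (chat1 chat2 : X → (Fin d → ℝ) → ℕ → ℝ) : Prop :=
  ∀ P ∈ simplexInt d, ∀ ε > (0 : ℝ), ∀ᶠ T : ℕ in atTop,
    ratio |chatStar chat1 P T - cstar ℓ P| |chatStar chat2 P T - cstar ℓ P| ≤ 1 + ε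

/-- The equivalence `≡_X̂` on prescriptors: `|ĉ₁* - c*|` and `|ĉ₂* - c*|` are
asymptotically equivalent as `T → ∞` for every `P ∈ 𝒫°`. -/
def PrescEquiv {X : Type*} {d : ℕ} (ℓ : X → Fin d → ℝ)
    (chat1 chat2 : X → (Fin d → ℝ) → ℕ → ℝ) : Prop :=
  ∀ P ∈ simplexInt d,
    (fun T : ℕ => |chatStar chat1 P T - cstar ℓ P|) ~[atTop]
      (fun T : ℕ => |chatStar chat2 P T - cstar ℓ P|)

lemma aux_sum_cons {d T : ℕ} (F : (Fin (T+1) → Fin d) → ℝ) :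
    ∑ ω, F ω = ∑ i : Fin d, ∑ ω : Fin T → Fin d, F (Fin.cons i ω) := by
  rw [← Fintype.sum_prod_type']
  exact (Fintype.sum_equiv (Fin.consEquiv (fun _ => Fin d)) _ _ (fun p => rfl)).symm

lemma aux_mass {d : ℕ} (w : Fin d → ℝ) (hw : ∑ i, w i = 1) (T : ℕ) :
    ∑ ω : Fin T → Fin d, ∏ t, w (ω t) = 1 := by
  induction T with
  | zero => simp
  | succ T ih =>
    rw [aux_sum_cons]
    simp only [Fin.prod_univ_succ, Fin.cons_zero, Fin.cons_succ, ← Finset.mul_sum, ih, mul_one, hw]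

lemma aux_mean {d : ℕ} (w g : Fin d → ℝ) (hw : ∑ i, w i = 1) (hg : ∑ i, w i * g i = 0) (T : ℕ) :
    ∑ ω : Fin T → Fin d, (∏ t, w (ω t)) * ∑ t, g (ω t) = 0 := by
  induction T with
  | zero => simp
  | succ T ih =>
    rw [aux_sum_cons]
    have h : ∀ i : Fin d, ∑ ω : Fin T → Fin d, (∏ t, w ((Fin.cons i ω : Fin (T+1) → Fin d) t)) *
        ∑ t, g ((Fin.cons i ω : Fin (T+1) → Fin d) t) = w i * g i := by
      intro i
      simp only [Fin.prod_univ_succ, Fin.sum_univ_succ, Fin.cons_zero, Fin.cons_succ]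
      have : ∀ ω : Fin T → Fin d, (w i * ∏ t, w (ω t)) * (g i + ∑ t, g (ω t)) =
        (w i * g i) * (∏ t, w (ω t)) + w i * ((∏ t, w (ω t)) * ∑ t, g (ω t)) := by
        intro ω; ring
      simp only [this, Finset.sum_add_distrib, ← Finset.mul_sum, ih, aux_mass w hw]
      ring
    simp only [h, hg]

lemma aux_second {d : ℕ} (w g : Fin d → ℝ) (hw : ∑ i, w i = 1) (hg : ∑ i, w i * g i = 0) (T : ℕ) :
    ∑ ω : Fin T → Fin d, (∏ t, w (ω t)) * (∑ t, g (ω t)) ^ 2 = T * ∑ i, w i * g i ^ 2 := by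
  induction T with
  | zero => simp
  | succ T ih =>
    rw [aux_sum_cons]
    have h : ∀ i : Fin d, ∑ ω : Fin T → Fin d, (∏ t, w ((Fin.cons i ω : Fin (T+1) → Fin d) t)) *
        (∑ t, g ((Fin.cons i ω : Fin (T+1) → Fin d) t)) ^ 2 =
          w i * g i ^ 2 + w i * (T * ∑ i, w i * g i ^ 2) := by
      intro i
      simp only [Fin.prod_univ_succ, Fin.sum_univ_succ, Fin.cons_zero, Fin.cons_succ]
      have : ∀ ω : Fin T → Fin d, (w i * ∏ t, w (ω t)) * (g i + ∑ t, g (ω t)) ^ 2 =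
        (w i * g i ^ 2) * (∏ t, w (ω t)) + (2 * w i * g i) * ((∏ t, w (ω t)) * ∑ t, g (ω t))
          + w i * ((∏ t, w (ω t)) * (∑ t, g (ω t)) ^ 2) := by
        intro ω; ring
      simp only [this, Finset.sum_add_distrib, ← Finset.mul_sum, ih, aux_mass w hw,
        aux_mean w g hw hg]
      ring
    simp only [h, Finset.sum_add_distrib, ← Finset.sum_mul, hw]
    push_cast
    ring

lemma aux_emp_sum {d T : ℕ} (hT : 0 < T) (ω : Fin T → Fin d) (h : Fin d → ℝ) :
    ∑ t, h (ω t) = T * ∑ i, empDist ω i * h i := by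
  have hT' : (T : ℝ) ≠ 0 := by positivity
  rw [← Finset.sum_fiberwise_of_maps_to (s := Finset.univ) (t := Finset.univ) (g := ω)
    (fun _ _ => Finset.mem_univ _), Finset.mul_sum]
  refine Finset.sum_congr rfl fun i _ => ?_
  rw [Finset.sum_congr rfl (g := fun _ => h i)]
  · rw [Finset.sum_const, nsmul_eq_mul, empDist]
    field_simp
  · intro t ht
    rw [(Finset.mem_filter.1 ht).2]

lemma aux_emp_mem {d T : ℕ} (hT : 0 < T) (ω : Fin T → Fin d) : empDist ω ∈ simplex d := by
  have hT' : (T : ℝ) ≠ 0 := by positivity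
  refine ⟨fun i => by unfold empDist; positivity, ?_⟩
  have := aux_emp_sum hT ω (fun _ => 1)
  simp only [Finset.sum_const, Finset.card_univ, Fintype.card_fin, nsmul_eq_mul, mul_one] at this
  field_simp at this
  linarith

lemma aux_cheb {d : ℕ} (Q : Fin d → ℝ) (hQ : Q ∈ simplexInt d) (T : ℕ) (hT : 0 < T)
    (r : ℝ) (hr : 0 < r) :
    1 - d / (T * r ^ 2) ≤ probT Q T (fun ω => ∀ i, |empDist ω i - Q i| < r) := by
  classical
  have hT' : (0 : ℝ) < T := by positivity
  have hW : ∀ ω : Fin T → Fin d, 0 ≤ ∏ t, Q (ω t) :=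
    fun ω => Finset.prod_nonneg fun t _ => (hQ.1 _).le
  -- second moments
  have hvar : ∀ i, ∑ ω : Fin T → Fin d, (∏ t, Q (ω t)) * (empDist ω i - Q i) ^ 2 ≤ 1 / T := by
    intro i
    have hQ1 : Q i ≤ 1 := by
      rw [← hQ.2]
      exact Finset.single_le_sum (f := Q) (fun j _ => (hQ.1 j).le) (Finset.mem_univ i)
    have hg : ∑ j, Q j * ((if j = i then 1 else 0) - Q i) = 0 := by
      simp [mul_sub, Finset.sum_sub_distrib, ← Finset.sum_mul, hQ.2]
    have h2 := aux_second Q (fun j => (if j = i then 1 else 0) - Q i) hQ.2 hg T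
    have hs : ∑ j, Q j * ((if j = i then 1 else 0) - Q i) ^ 2 ≤ 1 := by
      refine le_of_le_of_eq (Finset.sum_le_sum (g := Q) fun j _ => ?_) hQ.2
      have h0 := hQ.1 j
      have h0 := hQ.1 i
      have : ((if j = i then (1:ℝ) else 0) - Q i) ^ 2 ≤ 1 := by
        split_ifs <;> nlinarith
      nlinarith [hQ.1 j]
    have he : ∀ ω : Fin T → Fin d, ∑ t, (((if ω t = i then (1:ℝ) else 0) - Q i)) =
        T * (empDist ω i - Q i) := by
      intro ω
      rw [Finset.sum_sub_distrib, Finset.sum_boole, empDist]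
      simp
      field_simp
    simp only [he] at h2
    have h3 : ∑ ω : Fin T → Fin d, (∏ t, Q (ω t)) * (empDist ω i - Q i) ^ 2
        = (1 / T) * ∑ j, Q j * ((if j = i then 1 else 0) - Q i) ^ 2 := by
      have : ∀ ω : Fin T → Fin d, (∏ t, Q (ω t)) * (T * (empDist ω i - Q i)) ^ 2 =
        T ^ 2 * ((∏ t, Q (ω t)) * (empDist ω i - Q i) ^ 2) := by intro ω; ring
      simp only [this, ← Finset.mul_sum] at h2
      field_simp
      have hh : (T:ℝ) * (T * ∑ ω : Fin T → Fin d, (∏ t, Q (ω t)) * (empDist ω i - Q i) ^ 2) =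
        T * ∑ j, Q j * ((if j = i then 1 else 0) - Q i) ^ 2 := by rw [← h2]; ring
      linarith [mul_left_cancel₀ hT'.ne' hh]
    rw [h3]
    calc _ ≤ (1 / (T:ℝ)) * 1 := by gcongr
      _ = _ := by ring
  have hmain : ∀ ω : Fin T → Fin d, (∏ t, Q (ω t)) - ∑ i, (∏ t, Q (ω t)) * (empDist ω i - Q i) ^ 2 / r ^ 2
      ≤ if (∀ i, |empDist ω i - Q i| < r) then ∏ t, Q (ω t) else 0 := by
    intro ω
    split_ifs with h
    · have : 0 ≤ ∑ i, (∏ t, Q (ω t)) * (empDist ω i - Q i) ^ 2 / r ^ 2 :=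
        Finset.sum_nonneg fun i _ => by have := hW ω; positivity
      linarith
    · push Not at h
      obtain ⟨i, hi⟩ := h
      have h1 : (∏ t, Q (ω t)) * (empDist ω i - Q i) ^ 2 / r ^ 2 ≤
        ∑ i, (∏ t, Q (ω t)) * (empDist ω i - Q i) ^ 2 / r ^ 2 :=
        Finset.single_le_sum (f := fun i => (∏ t, Q (ω t)) * (empDist ω i - Q i) ^ 2 / r ^ 2)
          (fun i _ => by have := hW ω; positivity) (Finset.mem_univ i)
      have h2 : r ^ 2 ≤ (empDist ω i - Q i) ^ 2 := by
        rw [← sq_abs (empDist ω i - Q i)]; gcongr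
      have h3 : (∏ t, Q (ω t)) ≤ (∏ t, Q (ω t)) * (empDist ω i - Q i) ^ 2 / r ^ 2 := by
        rw [le_div_iff₀ (by positivity)]
        exact mul_le_mul_of_nonneg_left h2 (hW ω)
      linarith
  unfold probT
  refine le_trans ?_ (Finset.sum_le_sum (f := fun ω : Fin T → Fin d =>
    (∏ t, Q (ω t)) - ∑ i, (∏ t, Q (ω t)) * (empDist ω i - Q i) ^ 2 / r ^ 2) fun ω _ => ?_)
  rotate_left
  · refine (hmain ω).trans (le_of_eq ?_)
    congr
  · rw [Finset.sum_sub_distrib, aux_mass Q hQ.2, Finset.sum_comm]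
    simp only [← Finset.sum_div]
    have : ∑ i : Fin d, ∑ ω : Fin T → Fin d, (∏ t, Q (ω t)) * (empDist ω i - Q i) ^ 2 ≤
        ∑ i : Fin d, 1 / (T:ℝ) := Finset.sum_le_sum fun i _ => hvar i
    simp only [Finset.sum_const, Finset.card_univ, Fintype.card_fin, nsmul_eq_mul] at this
    have h5 : (∑ i : Fin d, ∑ ω : Fin T → Fin d, (∏ t, Q (ω t)) * (empDist ω i - Q i) ^ 2) / r ^ 2
      ≤ (d * (1 / (T:ℝ))) / r ^ 2 := by gcongr
    have h6 : (d * (1 / (T:ℝ))) / r ^ 2 = d / (T * r ^ 2) := by field_simp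
    linarith

lemma aux_log {u : ℝ} (hu : |u| ≤ 1 / 2) : Real.log (1 + u) ≤ u - u ^ 2 / 2 + 2 * |u| ^ 3 := by
  have h := Real.abs_log_sub_add_sum_range_le (x := -u) (by rw [abs_neg]; linarith) 2
  rw [abs_neg] at h
  simp [Finset.sum_range_succ] at h
  have h2 : |u| ^ 3 / (1 - |u|) ≤ 2 * |u| ^ 3 := by
    rw [div_le_iff₀ (by linarith)]
    have : 0 ≤ |u| ^ 3 := by positivity
    nlinarith
  have h3 := (abs_le.1 (h.trans h2)).2
  norm_num at h3
  linarith

lemma aux_phi {u : ℝ} (hu : |u| ≤ 1 / 2) : |u - u ^ 2 / 2 + 2 * |u| ^ 3| ≤ 2 * |u| := by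
  have h0 := abs_nonneg u
  have h1 : u ^ 2 = |u| ^ 2 := (sq_abs u).symm
  rw [h1]
  have h2 : |u| ^ 2 ≤ |u| / 2 := by nlinarith
  have h3 : |u| ^ 3 ≤ |u| / 4 := by
    have : |u| ^ 3 = |u| * |u| ^ 2 := by ring
    rw [this]; nlinarith
  have h4 : 0 ≤ |u| ^ 3 := by positivity
  rw [abs_le]
  constructor <;> nlinarith [neg_abs_le u, le_abs_self u, sq_nonneg |u|]

lemma aux_phi2 {u : ℝ} (hu : |u| ≤ 1 / 2) :
    (1 + u) * (u - u ^ 2 / 2 + 2 * |u| ^ 3) ≤ u + u ^ 2 / 2 + 4 * |u| ^ 3 := by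
  have h0 := abs_nonneg u
  have h4 : 0 ≤ |u| ^ 3 := by positivity
  have h5 : -u ^ 3 ≤ |u| ^ 3 := by rw [← abs_pow]; exact neg_le_abs _
  have h6 : u * |u| ^ 3 ≤ 1 / 2 * |u| ^ 3 := by
    gcongr; exact (le_abs_self u).trans hu
  nlinarith

lemma aux_taylor {d : ℕ} {f : ℕ → (Fin d → ℝ) → ℝ}
    {D : (Fin d → ℝ) → ℕ → ((Fin d → ℝ) →L[ℝ] ℝ)}
    (hD : ∀ (T : ℕ), ∀ P ∈ simplex d, HasFDerivWithinAt (f T) (D P T) (simplex d) P)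
    (P : Fin d → ℝ) (hP : P ∈ simplex d) (η δ : ℝ) (hδ : 0 < δ)
    (h : ∀ (T : ℕ), ∀ P' ∈ simplex d, dist P P' < δ → ‖D P T - D P' T‖ < η)
    (T : ℕ) (P' : Fin d → ℝ) (hP' : P' ∈ simplex d) (hd : dist P P' < δ) :
    |f T P' - f T P - D P T (P' - P)| ≤ η * ‖P' - P‖ := by
  have hconv : Convex ℝ (simplex d ∩ Metric.ball P δ) := by
    refine Convex.inter ?_ (convex_ball _ _)
    exact convex_stdSimplex ℝ (Fin d)
  refine hconv.norm_image_sub_le_of_norm_hasFDerivWithin_le' (f' := fun Q => D Q T)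
    (fun Q hQ => (hD T Q hQ.1).mono Set.inter_subset_left) (fun Q hQ => ?_)
    ⟨hP, Metric.mem_ball_self hδ⟩ ⟨hP', by rwa [Metric.mem_ball, dist_comm]⟩
  rw [norm_sub_rev]
  exact (h T Q hQ.1 (by rw [dist_comm]; exact hQ.2)).le

lemma aux_com {d : ℕ} (P Δ : Fin d → ℝ) (hP : P ∈ simplexInt d) (hΔ : ∑ i, Δ i = 0)
    (M : ℝ) (hM0 : 0 ≤ M) (hM : ∀ i, |Δ i| ≤ M * P i) (s : ℝ) (hs : 0 < s) (hsM : s * M ≤ 1 / 2)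
    (η : ℝ) (hη : 0 < η) (T : ℕ) (hT : 0 < T) (A : (Fin T → Fin d) → Prop)
    (hA : ∀ ω : Fin T → Fin d, (∀ i, |empDist ω i - (P i + s * Δ i)| < η * s) → A ω) :
    (1 - d / (T * (η * s) ^ 2)) *
      Real.exp (-(T * s ^ 2 * (ellNormSq P Δ + 4 * s * M ^ 3 + 2 * d * η * M))) ≤
      probT P T A := by
  classical
  set u : Fin d → ℝ := fun i => s * Δ i / P i with hu
  set Q : Fin d → ℝ := fun i => P i + s * Δ i with hQdef
  have hPu : ∀ i, P i * u i = s * Δ i := fun i => by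
    have := (hP.1 i).ne'
    simp only [hu]; field_simp
  have hus : ∀ i, |u i| ≤ s * M := fun i => by
    have h1 := hP.1 i
    simp only [hu]
    rw [abs_div, abs_mul, abs_of_pos hs, abs_of_pos h1, div_le_iff₀ h1]
    have := hM i
    nlinarith
  have hu2 : ∀ i, |u i| ≤ 1 / 2 := fun i => (hus i).trans hsM
  have hQu : ∀ i, Q i = P i * (1 + u i) := fun i => by
    simp only [hQdef]; rw [mul_add, hPu]; ring
  have h1u : ∀ i, 0 < 1 + u i := fun i => by linarith [neg_abs_le (u i), hu2 i]
  have hQ : Q ∈ simplexInt d := by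
    refine ⟨fun i => by rw [hQu]; exact mul_pos (hP.1 i) (h1u i), ?_⟩
    simp only [hQdef, Finset.sum_add_distrib, ← Finset.mul_sum, hΔ, hP.2]; ring
  have hcheb := aux_cheb Q hQ T hT (η * s) (by positivity)
  set B := ellNormSq P Δ + 4 * s * M ^ 3 + 2 * d * η * M with hB
  -- exponent bound
  have hexp : ∀ ω : Fin T → Fin d, (∀ i, |empDist ω i - Q i| < η * s) →
      ∑ i, empDist ω i * Real.log (1 + u i) ≤ s ^ 2 * B := by
    intro ω hω
    have hterm : ∀ i, empDist ω i * Real.log (1 + u i) ≤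
        s * Δ i + s ^ 2 * ((1 / 2) * (Δ i ^ 2 / P i)) + (4 * s ^ 3 * M ^ 3) * P i
          + 2 * η * s ^ 2 * M := by
      intro i
      have hp := hP.1 i
      have he := (aux_emp_mem hT ω).1 i
      have h1 : empDist ω i * Real.log (1 + u i) ≤
        empDist ω i * (u i - u i ^ 2 / 2 + 2 * |u i| ^ 3) :=
        mul_le_mul_of_nonneg_left (aux_log (hu2 i)) he
      have h2 : (empDist ω i - Q i) * (u i - u i ^ 2 / 2 + 2 * |u i| ^ 3) ≤
          (η * s) * (2 * (s * M)) := by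
        refine (le_abs_self _).trans ?_
        rw [abs_mul]
        refine mul_le_mul (hω i).le ((aux_phi (hu2 i)).trans ?_) (abs_nonneg _) (by positivity)
        linarith [hus i]
      have h3 : Q i * (u i - u i ^ 2 / 2 + 2 * |u i| ^ 3) ≤
          P i * (u i + u i ^ 2 / 2 + 4 * |u i| ^ 3) := by
        rw [hQu, mul_assoc]
        exact mul_le_mul_of_nonneg_left (aux_phi2 (hu2 i)) hp.le
      have h4 : P i * |u i| ^ 3 ≤ P i * (s * M) ^ 3 := by
        have := hus i
        gcongr
      have h5 : P i * u i ^ 2 = s ^ 2 * (Δ i ^ 2 / P i) := by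
        simp only [hu]; field_simp
      have h6 := hPu i
      nlinarith
    refine (Finset.sum_le_sum fun i _ => hterm i).trans (le_of_eq ?_)
    simp only [Finset.sum_add_distrib, ← Finset.mul_sum, hΔ, hP.2, Finset.sum_const,
      Finset.card_univ, Fintype.card_fin, nsmul_eq_mul, hB, ellNormSq]
    ring
  have hpt : ∀ ω : Fin T → Fin d, (∀ i, |empDist ω i - Q i| < η * s) →
      (∏ t, Q (ω t)) * Real.exp (-(T * s ^ 2 * B)) ≤ ∏ t, P (ω t) := by
    intro ω hω
    have h1 : ∏ t, Q (ω t) = (∏ t, P (ω t)) * Real.exp (T * ∑ i, empDist ω i * Real.log (1 + u i)) := by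
      rw [← aux_emp_sum hT ω (fun i => Real.log (1 + u i)), Real.exp_sum, ← Finset.prod_mul_distrib]
      refine Finset.prod_congr rfl fun t _ => ?_
      rw [Real.exp_log (h1u _), hQu]
    rw [h1, mul_assoc, ← Real.exp_add]
    have hp : 0 ≤ ∏ t, P (ω t) := Finset.prod_nonneg fun t _ => (hP.1 _).le
    refine mul_le_of_le_one_right hp ?_
    rw [Real.exp_le_one_iff]
    have := mul_le_mul_of_nonneg_left (hexp ω hω) (Nat.cast_nonneg (α := ℝ) T)
    nlinarith
  refine (mul_le_mul_of_nonneg_right hcheb (Real.exp_pos _).le).trans ?_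
  unfold probT
  rw [Finset.sum_mul]
  refine Finset.sum_le_sum fun ω _ => ?_
  by_cases h : ∀ i, |empDist ω i - Q i| < η * s
  · rw [if_pos h, if_pos (hA ω h)]
    exact hpt ω h
  · rw [if_neg h, zero_mul]
    split_ifs
    · exact Finset.prod_nonneg fun t _ => (hP.1 _).le
    · exact le_rfl

lemma aux_int_sub {d : ℕ} {P : Fin d → ℝ} (hP : P ∈ simplexInt d) : P ∈ simplex d :=
  ⟨fun i => (hP.1 i).le, hP.2⟩

lemma aux_consist {X : Type*} [MetricSpace X] {d : ℕ}
    (ℓ : X → Fin d → ℝ) (a : ℕ → ℝ) (ha_top : Tendsto a atTop atTop)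
    (chat : X → (Fin d → ℝ) → ℕ → ℝ)
    (hreg : IsRegularPredictor d chat) (hOOS : OOSGuarantee ℓ a chat)
    (x : X) (P : Fin d → ℝ) (hP : P ∈ simplexInt d) (η : ℝ) (hη : 0 < η) :
    ∀ᶠ T : ℕ in atTop, cost ℓ x P - η ≤ chat x P T := by
  classical
  obtain ⟨δ, hδ, hc⟩ := hreg.equicontinuous x P (aux_int_sub hP) η hη
  have h1 : ∀ᶠ T : ℕ in atTop, (d : ℝ) / (T * δ ^ 2) < 1 / 2 := by
    have : Tendsto (fun T : ℕ => (d : ℝ) / (T * δ ^ 2)) atTop (nhds 0) := by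
      refine Tendsto.div_atTop tendsto_const_nhds ?_
      exact tendsto_natCast_atTop_atTop.atTop_mul_const (by positivity)
    exact this.eventually (gt_mem_nhds (by norm_num))
  filter_upwards [hOOS x P hP (1/2) (by norm_num), h1, eventually_gt_atTop 0,
    ha_top.eventually_ge_atTop 4] with T hT1 hT2 hT3 hT4
  by_contra hcon
  push Not at hcon
  have hch := aux_cheb P hP T hT3 δ hδ
  have hle : probT P T (fun ω => ∀ i, |empDist ω i - P i| < δ) ≤
      probT P T (fun ω => cost ℓ x P > chat x (empDist ω) T) := by
    unfold probT
    refine Finset.sum_le_sum fun ω _ => ?_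
    have hp : 0 ≤ ∏ t, P (ω t) := Finset.prod_nonneg fun t _ => (hP.1 _).le
    by_cases h : ∀ i, |empDist ω i - P i| < δ
    · rw [if_pos h, if_pos]
      have hd : dist P (empDist ω) < δ := by
        rw [dist_comm, dist_pi_lt_iff hδ]
        exact h
      have := hc T x (empDist ω) (aux_emp_mem hT3 ω) (by simpa using hδ) hd
      have := (abs_lt.1 this).1
      linarith
    · rw [if_neg h]
      split_ifs
      · exact hp
      · exact le_rfl
  have he : Real.exp ((-1 + 1 / 2) * a T) ≤ 1 / 2 := by
    have h3 : Real.exp ((-1 + 1 / 2) * a T) ≤ Real.exp (-1) := by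
      rw [Real.exp_le_exp]; linarith
    have h4 := Real.exp_neg_one_lt_half
    linarith
  linarith

set_option maxHeartbeats 1000000 in
lemma aux_dir {X : Type*} [MetricSpace X] {d : ℕ}
    (ℓ : X → Fin d → ℝ) (a : ℕ → ℝ) (ha_pos : ∀ T, 0 < a T)
    (ha_top : Tendsto a atTop atTop)
    (ha_sub : Tendsto (fun T : ℕ => a T / (T : ℝ)) atTop (nhds 0))
    (chat : X → (Fin d → ℝ) → ℕ → ℝ)
    (hreg : IsRegularPredictor d chat) (hOOS : OOSGuarantee ℓ a chat)
    (x : X) (P : Fin d → ℝ) (hP : P ∈ simplexInt d) (Δ : Fin d → ℝ) (hΔ : ∑ i, Δ i = 0)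
    (hI : ellNormSq P Δ < 1) (η : ℝ) (hη : 0 < η) :
    ∀ᶠ T : ℕ in atTop, cost ℓ x P + Real.sqrt (a T / T) * (- (∑ i, ℓ x i * Δ i) - η)
      ≤ chat x P T := by
  obtain ⟨D, hD, ⟨K, hK⟩, hDe⟩ := hreg.differentiableDeriv
  have hPs := aux_int_sub hP
  set L := ∑ i, ℓ x i * Δ i with hL
  set N := ‖Δ‖ with hN
  have hN0 : 0 ≤ N := norm_nonneg _
  set M := ∑ i, |Δ i| / P i with hMdef
  have hMn : ∀ i ∈ Finset.univ, 0 ≤ |Δ i| / P i := fun i _ => by have := hP.1 i; positivity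
  have hM0 : 0 ≤ M := Finset.sum_nonneg hMn
  have hM : ∀ i, |Δ i| ≤ M * P i := fun i => by
    rw [← div_le_iff₀ (hP.1 i)]
    exact Finset.single_le_sum (f := fun i => |Δ i| / P i) hMn (Finset.mem_univ i)
  set ε := (1 - ellNormSq P Δ) / 4 with hε
  have hε0 : 0 < ε := by rw [hε]; linarith
  -- Taylor expansion
  set η0 := η / (8 * (N + 1)) with hη0
  have hη00 : 0 < η0 := by positivity
  have hη0N : η0 * (N + 1) = η / 8 := by rw [hη0]; field_simp
  obtain ⟨δ, hδ, hDδ⟩ := hDe x P hPs η0 hη00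
  have htay : ∀ (T : ℕ), ∀ P' ∈ simplex d, dist P P' < δ →
      |chat x P' T - chat x P T - D x P T (P' - P)| ≤ η0 * ‖P' - P‖ := by
    intro T P' hP' hd
    exact aux_taylor (f := fun T Q => chat x Q T) (D := fun Q T => D x Q T)
      (fun T Q hQ => hD T x Q hQ) P hPs η0 δ hδ
      (fun T Q hQ hdQ => hDδ T x Q hQ (by simpa using hδ) hdQ) T P' hP' hd
  -- base point for the derivative bound
  obtain ⟨t, ht0, htN, htM⟩ : ∃ t : ℝ, 0 < t ∧ t * N < δ ∧ t * M < 1 := by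
    refine ⟨min (δ / (N + 1)) (1 / (M + 1)), by positivity, ?_, ?_⟩
    · calc _ ≤ δ / (N + 1) * N := by gcongr; exact min_le_left _ _
        _ < δ := by rw [div_mul_eq_mul_div, div_lt_iff₀ (by positivity)]; nlinarith
    · calc _ ≤ 1 / (M + 1) * M := by gcongr; exact min_le_right _ _
        _ < 1 := by rw [div_mul_eq_mul_div, div_lt_iff₀ (by positivity)]; nlinarith
  set P₁ : Fin d → ℝ := P - t • Δ with hP₁
  have hP₁i : P₁ ∈ simplexInt d := by
    refine ⟨fun i => ?_, ?_⟩
    · simp only [hP₁, Pi.sub_apply, Pi.smul_apply, smul_eq_mul]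
      have h1 : t * Δ i ≤ t * (M * P i) :=
        mul_le_mul_of_nonneg_left ((le_abs_self _).trans (hM i)) ht0.le
      have := hP.1 i
      nlinarith
    · simp only [hP₁, Pi.sub_apply, Pi.smul_apply, smul_eq_mul, Finset.sum_sub_distrib,
        ← Finset.mul_sum, hΔ, hP.2]; ring
  have hcost₁ : cost ℓ x P₁ = cost ℓ x P - t * L := by
    simp only [cost, hP₁, hL, Pi.sub_apply, Pi.smul_apply, smul_eq_mul, Finset.mul_sum,
      ← Finset.sum_sub_distrib]
    exact Finset.sum_congr rfl fun i _ => by ring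
  have hsub₁ : P₁ - P = -(t • Δ) := by rw [hP₁]; abel
  have hnorm₁ : ‖P₁ - P‖ = t * N := by
    rw [hsub₁, norm_neg, norm_smul, Real.norm_eq_abs, abs_of_pos ht0]
  have hdist₁ : dist P P₁ < δ := by rw [dist_comm, dist_eq_norm, hnorm₁]; exact htN
  -- concentration radius
  obtain ⟨r, hr0, hr1, hrK, hrM⟩ : ∃ r : ℝ, 0 < r ∧ r ≤ 1 ∧ |K| * r ≤ η / 8 ∧
      2 * d * r * M ≤ ε := by
    refine ⟨min 1 (min (η / (8 * (|K| + 1))) (ε / (2 * d * M + 1))), by positivity,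
      min_le_left _ _, ?_, ?_⟩
    · calc _ ≤ |K| * (η / (8 * (|K| + 1))) := by
            gcongr; exact (min_le_right _ _).trans (min_le_left _ _)
        _ ≤ η / 8 := by
            rw [mul_div_assoc', div_le_div_iff₀ (by positivity) (by positivity)]
            nlinarith [abs_nonneg K]
    · calc _ ≤ 2 * d * (ε / (2 * d * M + 1)) * M := by
            gcongr; exact (min_le_right _ _).trans (min_le_right _ _)
        _ = ε * (2 * d * M) / (2 * d * M + 1) := by ring
        _ ≤ ε := by
            rw [div_le_iff₀ (by positivity)]
            nlinarith
  -- smallness of s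
  have hs : Tendsto (fun T : ℕ => Real.sqrt (a T / T)) atTop (nhds 0) := by
    have := (Real.continuous_sqrt.tendsto 0).comp ha_sub
    rw [Real.sqrt_zero] at this
    exact this
  have hsC : ∀ C b : ℝ, 0 < b → ∀ᶠ T : ℕ in atTop, Real.sqrt (a T / T) * C < b := by
    intro C b hb
    have := hs.mul_const C
    rw [zero_mul] at this
    exact this.eventually (gt_mem_nhds hb)
  have hrare : ∀ᶠ T : ℕ in atTop, (d : ℝ) / (a T * r ^ 2) < 1 / 2 := by
    have : Tendsto (fun T : ℕ => (d : ℝ) / (a T * r ^ 2)) atTop (nhds 0) := by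
      refine Tendsto.div_atTop tendsto_const_nhds ?_
      exact ha_top.atTop_mul_const (by positivity)
    exact this.eventually (gt_mem_nhds (by norm_num))
  filter_upwards [hOOS x P hP ε hε0, hrare, eventually_gt_atTop 0,
    ha_top.eventually_ge_atTop (1 / ε), hsC M (1/2) (by norm_num), hsC (4 * M ^ 3) ε hε0,
    hsC |L| (t * η / 8) (by positivity), hsC (N + 1) δ hδ,
    aux_consist ℓ a ha_top chat hreg hOOS x P₁ hP₁i (t * η / 8) (by positivity)]
    with T hT1 hT2 hT3 hT4 hT5 hT6 hT7 hT8 hT9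
  by_contra hcon
  push Not at hcon
  set s := Real.sqrt (a T / T) with hsdef
  have hTpos : (0 : ℝ) < T := by exact_mod_cast hT3
  have hapos := ha_pos T
  have hs0 : 0 < s := Real.sqrt_pos.2 (by positivity)
  have hTs : T * s ^ 2 = a T := by
    rw [hsdef, Real.sq_sqrt (by positivity)]; field_simp
  -- derivative bound
  have hDΔ : D x P T Δ ≤ L + 3 * η / 8 := by
    have h1 := (abs_le.1 (htay T P₁ (aux_int_sub hP₁i) hdist₁)).2
    rw [hnorm₁, hsub₁, map_neg, map_smul, smul_eq_mul] at h1
    have h2 : η0 * (t * N) ≤ t * (η / 8) := by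
      rw [← hη0N]; nlinarith [mul_pos hη00 ht0]
    have h3 : s * (-L - η) ≤ s * |L| := by
      gcongr; linarith [neg_abs_le L]
    have h4 : t * D x P T Δ ≤ t * (L + 3 * η / 8) := by
      rw [hcost₁] at hT9
      linarith
    exact le_of_mul_le_mul_left h4 ht0
  have hevent : ∀ ω : Fin T → Fin d, (∀ i, |empDist ω i - (P i + s * Δ i)| < r * s) →
      cost ℓ x P > chat x (empDist ω) T := by
    intro ω hω
    set E : Fin d → ℝ := empDist ω - P - s • Δ with hE
    have hEn : ‖E‖ ≤ r * s := by
      rw [pi_norm_le_iff_of_nonneg (by positivity)]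
      intro i
      have := (hω i).le
      rw [Real.norm_eq_abs]
      simp only [hE, Pi.sub_apply, Pi.smul_apply, smul_eq_mul]
      rwa [sub_sub]
    have hdec : empDist ω - P = s • Δ + E := by rw [hE]; abel
    have hn : ‖empDist ω - P‖ ≤ s * (N + 1) := by
      rw [hdec]
      refine (norm_add_le _ _).trans ?_
      rw [norm_smul, Real.norm_eq_abs, abs_of_pos hs0]
      linarith [mul_le_mul_of_nonneg_right hr1 hs0.le]
    have hd : dist P (empDist ω) < δ := by
      rw [dist_comm, dist_eq_norm]; linarith
    have h1 := (abs_le.1 (htay T _ (aux_emp_mem hT3 ω) hd)).2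
    have h2 : D x P T (empDist ω - P) ≤ s * (L + 3 * η / 8) + s * (η / 8) := by
      rw [hdec, map_add, map_smul, smul_eq_mul]
      have h3 : D x P T E ≤ |K| * (r * s) := by
        refine (le_abs_self _).trans (((D x P T).le_opNorm E).trans ?_)
        exact mul_le_mul ((hK T x P hPs).trans (le_abs_self K)) hEn (norm_nonneg _) (abs_nonneg _)
      have h4 : |K| * (r * s) ≤ s * (η / 8) := by
        linarith [mul_le_mul_of_nonneg_left hrK hs0.le]
      have h5 : s * D x P T Δ ≤ s * (L + 3 * η / 8) := by gcongr
      linarith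
    have h6 : η0 * ‖empDist ω - P‖ ≤ s * (η / 8) := by
      rw [← hη0N]
      linarith [mul_le_mul_of_nonneg_left hn hη00.le]
    have h7 : 0 < s * η := by positivity
    linarith
  have hlow := aux_com P Δ hP hΔ M hM0 hM s hs0 hT5.le r hr0 T hT3 _ hevent
  have hmul : (T : ℝ) * (r * s) ^ 2 = a T * r ^ 2 := by rw [← hTs]; ring
  rw [hTs, hmul] at hlow
  have h1 : Real.exp (-(a T * (1 - 2 * ε))) ≤
      Real.exp (-(a T * (ellNormSq P Δ + 4 * s * M ^ 3 + 2 * d * r * M))) := by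
    rw [Real.exp_le_exp]
    have : ellNormSq P Δ + 4 * s * M ^ 3 + 2 * d * r * M ≤ 1 - 2 * ε := by
      have : ellNormSq P Δ = 1 - 4 * ε := by rw [hε]; ring
      linarith
    exact neg_le_neg (mul_le_mul_of_nonneg_left this hapos.le)
  have h2 : (1 / 2) * Real.exp (-(a T * (1 - 2 * ε))) ≤ Real.exp ((-1 + ε) * a T) := by
    refine le_trans ?_ (hlow.trans hT1)
    refine mul_le_mul (by linarith) h1 (Real.exp_pos _).le (by linarith)
  have h3 : Real.exp (-(a T * (1 - 2 * ε))) = Real.exp ((-1 + ε) * a T) * Real.exp (ε * a T) := by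
    rw [← Real.exp_add]; congr 1; ring
  have h4 : 2 < Real.exp (ε * a T) := by
    have h5 : 1 ≤ ε * a T := by
      rw [div_le_iff₀ hε0] at hT4; linarith
    have := Real.exp_one_gt_d9
    have h6 := Real.exp_le_exp.2 h5
    linarith
  rw [h3] at h2
  linarith [mul_lt_mul_of_pos_left h4 (Real.exp_pos ((-1 + ε) * a T))]

lemma aux_var {X : Type*} {d : ℕ} (ℓ : X → Fin d → ℝ) (x : X) (P : Fin d → ℝ)
    (hP : P ∈ simplexInt d) :
    varLoss ℓ x P = ∑ i, P i * (ℓ x i - cost ℓ x P) ^ 2 := by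
  have h : ∀ i, P i * (ℓ x i - cost ℓ x P) ^ 2 = ℓ x i ^ 2 * P i
      - 2 * cost ℓ x P * (ℓ x i * P i) + cost ℓ x P ^ 2 * P i := fun i => by ring
  simp only [h, Finset.sum_add_distrib, Finset.sum_sub_distrib, ← Finset.mul_sum, hP.2]
  rw [varLoss]
  have : ∑ i, ℓ x i * P i = cost ℓ x P := rfl
  rw [this]; ring

/-- In the subexponential regime, every regular predictor satisfying the out-of-sample
guarantee adds at least as much regularization as SVP:
`liminf √(T/a_T)·(ĉ - c) ≥ limsup √(T/a_T)·|ĉ_V - c| = √(2·Var_P(ℓ(x,ξ)))`. -/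
theorem stmt_7 {X : Type*} [MetricSpace X] [CompactSpace X] {d : ℕ}
    (ℓ : X → Fin d → ℝ) (hℓ : ∀ i, Continuous fun x => ℓ x i)
    (a : ℕ → ℝ) (ha_pos : ∀ T, 0 < a T)
    (ha_top : Tendsto a atTop atTop)
    (ha_sub : Tendsto (fun T : ℕ => a T / (T : ℝ)) atTop (nhds 0))
    (chat : X → (Fin d → ℝ) → ℕ → ℝ)
    (hreg : IsRegularPredictor d chat) (hOOS : OOSGuarantee ℓ a chat)
    (x : X) (P : Fin d → ℝ) (hP : P ∈ simplexInt d) :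
    (∀ ε > (0 : ℝ), ∀ᶠ T : ℕ in atTop,
        Real.sqrt (2 * varLoss ℓ x P) - ε ≤
          Real.sqrt ((T : ℝ) / a T) * (chat x P T - cost ℓ x P)) ∧
      Tendsto
        (fun T : ℕ => Real.sqrt ((T : ℝ) / a T) * |cV a ℓ x P T - cost ℓ x P|)
        atTop (nhds (Real.sqrt (2 * varLoss ℓ x P))) := by
  constructor
  · intro ε hε
    set V := varLoss ℓ x P with hV
    have hVe : V = ∑ i, P i * (ℓ x i - cost ℓ x P) ^ 2 := aux_var ℓ x P hP
    have hV0 : 0 ≤ V := by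
      rw [hVe]
      exact Finset.sum_nonneg fun i _ => mul_nonneg (hP.1 i).le (sq_nonneg _)
    set R := Real.sqrt (2 * V) with hR
    have hR0 : 0 ≤ R := Real.sqrt_nonneg _
    have hR2 : R ^ 2 = 2 * V := Real.sq_sqrt (by positivity)
    obtain ⟨δ, hδ0, hδ1, hδR⟩ : ∃ δ : ℝ, 0 < δ ∧ δ ≤ 1 ∧ δ * R ≤ ε / 2 := by
      refine ⟨min 1 (ε / (2 * (R + 1))), by positivity, min_le_left _ _, ?_⟩
      calc _ ≤ ε / (2 * (R + 1)) * R := by gcongr; exact min_le_right _ _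
        _ ≤ ε / 2 := by
          rw [div_mul_eq_mul_div, div_le_div_iff₀ (by positivity) (by positivity)]
          nlinarith
    set κ := (1 - δ) * (R / V) with hκ
    have hκV : κ * V = (1 - δ) * R := by
      rcases eq_or_ne V 0 with h | h
      · have : R = 0 := by rw [hR, h]; simp
        rw [h, this]; simp
      · rw [hκ]; field_simp
    have hκV2 : κ ^ 2 * V < 2 := by
      rcases eq_or_ne V 0 with h | h
      · rw [h]; norm_num
      · have h1 : κ ^ 2 * V = 2 * (1 - δ) ^ 2 := by
          have : κ ^ 2 * V * V = 2 * (1 - δ) ^ 2 * V := by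
            calc κ ^ 2 * V * V = (κ * V) ^ 2 := by ring
              _ = (1 - δ) ^ 2 * R ^ 2 := by rw [hκV]; ring
              _ = _ := by rw [hR2]; ring
          exact mul_right_cancel₀ h this
        rw [h1]; nlinarith
    set Δ : Fin d → ℝ := fun i => -κ * (P i * (ℓ x i - cost ℓ x P)) with hΔdef
    have hc0 : ∑ i, P i * (ℓ x i - cost ℓ x P) = 0 := by
      have h : ∀ i, P i * (ℓ x i - cost ℓ x P) = ℓ x i * P i - cost ℓ x P * P i :=
        fun i => by ring
      simp only [h, Finset.sum_sub_distrib, ← Finset.mul_sum, hP.2]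
      rw [cost]; ring
    have hΔ : ∑ i, Δ i = 0 := by
      simp only [hΔdef, ← Finset.mul_sum, hc0, mul_zero]
    have hL : ∑ i, ℓ x i * Δ i = -((1 - δ) * R) := by
      have h : ∀ i, ℓ x i * Δ i = -κ * (P i * (ℓ x i - cost ℓ x P) ^ 2)
          + (-κ * cost ℓ x P) * (P i * (ℓ x i - cost ℓ x P)) := fun i => by
        simp only [hΔdef]; ring
      simp only [h, Finset.sum_add_distrib, ← Finset.mul_sum, hc0, ← hVe]
      rw [← hκV]; ring
    have hI : ellNormSq P Δ < 1 := by
      have h : ∀ i, Δ i ^ 2 / P i = κ ^ 2 * (P i * (ℓ x i - cost ℓ x P) ^ 2) := fun i => by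
        have := (hP.1 i).ne'
        simp only [hΔdef]; field_simp
      rw [ellNormSq]
      simp only [h, ← Finset.mul_sum, ← hVe]
      linarith
    filter_upwards [aux_dir ℓ a ha_pos ha_top ha_sub chat hreg hOOS x P hP Δ hΔ hI (ε / 2)
      (by positivity), eventually_gt_atTop 0] with T hT hT0
    have hTpos : (0 : ℝ) < T := by exact_mod_cast hT0
    have hapos := ha_pos T
    have hprod : Real.sqrt (T / a T) * Real.sqrt (a T / T) = 1 := by
      rw [← Real.sqrt_mul (by positivity)]
      have : (T : ℝ) / a T * (a T / T) = 1 := by field_simp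
      rw [this, Real.sqrt_one]
    rw [hL] at hT
    have h1 : Real.sqrt (a T / T) * (R - ε) ≤ chat x P T - cost ℓ x P := by
      have : Real.sqrt (a T / T) * (R - ε) ≤
          Real.sqrt (a T / T) * (-(-((1 - δ) * R)) - ε / 2) := by
        exact mul_le_mul_of_nonneg_left (by linarith) (Real.sqrt_nonneg _)
      linarith
    calc R - ε = Real.sqrt (T / a T) * (Real.sqrt (a T / T) * (R - ε)) := by
          rw [← mul_assoc, hprod, one_mul]
      _ ≤ _ := by gcongr
  · refine tendsto_const_nhds.congr' ?_
    filter_upwards [eventually_gt_atTop 0] with T hT0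
    have hTpos : (0 : ℝ) < T := by exact_mod_cast hT0
    have hapos := ha_pos T
    rw [cV, add_sub_cancel_left, abs_of_nonneg (Real.sqrt_nonneg _),
      ← Real.sqrt_mul (by positivity)]
    congr 1
    field_simp

end DDO
end

section
/- Let (a_T) be a sequence of positive reals with a_T → ∞ and a_T/T → 0 (the subexponential regime). For any sequence of maps x̂_{V,T} : 𝒫° → 𝒳 with x̂_{V,T}(P) ∈ argmin_{x∈𝒳} ĉ_V(x,P,T) for all P ∈ 𝒫° and T, the pair (ĉ_V, x̂_V) satisfies the prescription out-of-sample guarantee: limsup_{T→∞} (1/a_T)·log ℙ^∞( c(x̂_{V,T}(P̂_T),P) > ĉ_V*(P̂_T,T) ) ≤ −1 for every P ∈ 𝒫°, where ĉ_V*(P,T) := min_{x∈𝒳} ĉ_V(x,P,T). -/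
open Filter Asymptotics

namespace DDO

/-- Markov / Chernoff bound for a linear functional of the empirical distribution. -/
lemma chernoff_aux {d : ℕ} (P : Fin d → ℝ) (hP : ∀ i, 0 < P i) (f : Fin d → ℝ) (T : ℕ)
    (hT : 0 < T) (θ s : ℝ) (hθ : 0 ≤ θ) :
    probT P T (fun ω => s ≤ ∑ i, f i * (empDist ω i - P i)) ≤
      Real.exp (-(θ * T * s)) * (∑ i, P i * Real.exp (θ * (f i - ∑ j, f j * P j))) ^ T := by
  classical
  have hT' : (0 : ℝ) < T := by exact_mod_cast hT
  unfold probT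
  rw [Fintype.sum_pow, Finset.mul_sum]
  apply Finset.sum_le_sum
  intro ω _
  rw [Finset.prod_mul_distrib, ← Real.exp_sum]
  have hprod : 0 < ∏ t, P (ω t) := Finset.prod_pos (fun t _ => hP _)
  have key : ∑ t, θ * (f (ω t) - ∑ j, f j * P j)
      = θ * T * ∑ i, f i * (empDist ω i - P i) := by
    have h1 : ∑ t, f (ω t) = T * ∑ i, f i * empDist ω i := by
      rw [← Finset.sum_fiberwise (s := Finset.univ) (g := ω) (f := fun t => f (ω t)),
        Finset.mul_sum]
      apply Finset.sum_congr rfl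
      intro i _
      have h2 : ∑ t ∈ Finset.univ.filter (fun t => ω t = i), f (ω t)
          = ∑ t ∈ Finset.univ.filter (fun t => ω t = i), f i := by
        apply Finset.sum_congr rfl
        intro t ht
        rw [(Finset.mem_filter.mp ht).2]
      rw [h2, Finset.sum_const, nsmul_eq_mul]
      unfold empDist
      field_simp
    rw [← Finset.mul_sum, Finset.sum_sub_distrib, h1]
    simp only [mul_sub, Finset.sum_sub_distrib, Finset.sum_const, Finset.card_univ,
      Fintype.card_fin, nsmul_eq_mul]
    ring
  rw [key]
  split_ifs with h
  · have h3 : 1 ≤ Real.exp (-(θ * T * s)) *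
        Real.exp (θ * T * ∑ i, f i * (empDist ω i - P i)) := by
      rw [← Real.exp_add]
      apply Real.one_le_exp
      have := mul_le_mul_of_nonneg_left h (by positivity : 0 ≤ θ * T)
      linarith
    nlinarith
  · positivity

/-- Local quadratic bound for the exponential. -/
lemma exp_quad (δ : ℝ) (hδ : 0 < δ) : ∃ x₀ > (0 : ℝ), ∀ x : ℝ, |x| ≤ x₀ →
    Real.exp x ≤ 1 + x + x ^ 2 * (1 + δ) / 2 := by
  refine ⟨min 1 (δ / 2), by positivity, fun x hx => ?_⟩
  have h1 : |x| ≤ 1 := hx.trans (min_le_left _ _)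
  have h2 : |x| ≤ δ / 2 := hx.trans (min_le_right _ _)
  have h := Real.exp_bound h1 (n := 3) (by norm_num)
  have h' := (abs_le.mp h).2
  simp [Finset.sum_range_succ, Nat.factorial] at h'
  have h3 : |x| ^ 3 = |x| * x ^ 2 := by rw [← sq_abs x]; ring
  rw [h3] at h'
  have h4 : |x| * x ^ 2 ≤ δ / 2 * x ^ 2 := mul_le_mul_of_nonneg_right h2 (sq_nonneg x)
  have h5 : 0 ≤ |x| * x ^ 2 := by positivity
  nlinarith

/-- Local subgaussian bound for the moment generating function. -/
lemma mgf_aux {d : ℕ} (P : Fin d → ℝ) (hP : P ∈ simplexInt d) (f : Fin d → ℝ)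
    (hf : ∑ i, P i * f i ^ 2 ≤ 1) (δ : ℝ) (hδ : 0 < δ) :
    ∃ θ₀ > (0 : ℝ), ∀ θ : ℝ, 0 ≤ θ → θ ≤ θ₀ →
      ∑ i, P i * Real.exp (θ * (f i - ∑ j, f j * P j)) ≤ Real.exp (θ ^ 2 * (1 + δ) / 2) := by
  obtain ⟨x₀, hx₀, hx⟩ := exp_quad δ hδ
  obtain ⟨hpos, hsum⟩ := hP
  set m := ∑ j, f j * P j with hm
  set B := ∑ i, |f i - m| with hB
  have hB0 : 0 ≤ B := Finset.sum_nonneg (fun i _ => abs_nonneg _)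
  refine ⟨x₀ / (B + 1), by positivity, fun θ h0 h1 => ?_⟩
  have hb : ∀ i, |f i - m| ≤ B := fun i =>
    Finset.single_le_sum (f := fun i => |f i - m|) (fun i _ => abs_nonneg _) (Finset.mem_univ i)
  have hθ : ∀ i, |θ * (f i - m)| ≤ x₀ := by
    intro i
    rw [abs_mul, abs_of_nonneg h0]
    calc θ * |f i - m| ≤ x₀ / (B + 1) * (B + 1) := by
          apply mul_le_mul h1 _ (abs_nonneg _) (by positivity)
          linarith [hb i]
      _ = x₀ := by field_simp
  have hmean : ∑ i, P i * (f i - m) = 0 := by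
    simp only [mul_sub, Finset.sum_sub_distrib, ← Finset.sum_mul, hsum]
    rw [hm]; simp [mul_comm]
  have hvar : ∑ i, P i * (f i - m) ^ 2 ≤ 1 := by
    have : ∑ i, P i * (f i - m) ^ 2 = ∑ i, P i * f i ^ 2 - m ^ 2 := by
      have e : ∀ i, P i * (f i - m) ^ 2 = P i * f i ^ 2 - 2 * m * (f i * P i) + m ^ 2 * P i := by
        intro i; ring
      simp only [e, Finset.sum_add_distrib, Finset.sum_sub_distrib, ← Finset.mul_sum, hsum, ← hm]
      ring
    nlinarith [sq_nonneg m]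
  calc ∑ i, P i * Real.exp (θ * (f i - m))
      ≤ ∑ i, P i * (1 + θ * (f i - m) + (θ * (f i - m)) ^ 2 * (1 + δ) / 2) :=
        Finset.sum_le_sum (fun i _ => mul_le_mul_of_nonneg_left (hx _ (hθ i)) (hpos i).le)
    _ = 1 + θ * ∑ i, P i * (f i - m) + θ ^ 2 * (1 + δ) / 2 * ∑ i, P i * (f i - m) ^ 2 := by
        have h1s : (1 : ℝ) + θ * ∑ i, P i * (f i - m) = ∑ i, P i + θ * ∑ i, P i * (f i - m) := by
          rw [hsum]
        rw [h1s, Finset.mul_sum, Finset.mul_sum, ← Finset.sum_add_distrib,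
          ← Finset.sum_add_distrib]
        apply Finset.sum_congr rfl
        intro i _
        ring
    _ ≤ θ ^ 2 * (1 + δ) / 2 + 1 := by
        rw [hmean]
        have : 0 ≤ θ ^ 2 * (1 + δ) / 2 := by positivity
        nlinarith
    _ ≤ _ := Real.add_one_le_exp _

/-- Union bound. -/
lemma probT_union {d : ℕ} (P : Fin d → ℝ) (hP : ∀ i, 0 < P i) (T : ℕ) {ι : Type*}
    (N : Finset ι) (A : (Fin T → Fin d) → Prop) (B : ι → (Fin T → Fin d) → Prop)
    (h : ∀ ω, A ω → ∃ f ∈ N, B f ω) :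
    probT P T A ≤ ∑ f ∈ N, probT P T (B f) := by
  classical
  unfold probT
  rw [Finset.sum_comm]
  apply Finset.sum_le_sum
  intro ω _
  have hprod : 0 < ∏ t, P (ω t) := Finset.prod_pos (fun t _ => hP _)
  have hnn : ∀ f ∈ N, 0 ≤ (if B f ω then ∏ t, P (ω t) else 0) := by
    intro f _
    split_ifs
    · exact hprod.le
    · exact le_rfl
  by_cases hA : A ω
  · obtain ⟨f, hf, hB⟩ := h ω hA
    have := Finset.single_le_sum hnn hf
    simpa [hA, hB] using this
  · simp only [hA, if_false]
    exact Finset.sum_nonneg hnn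

/-- Finite net of directions on the unit sphere. -/
lemma net_aux (d : ℕ) (δ : ℝ) (hδ : 0 < δ) :
    ∃ N : Finset (Fin d → ℝ), (∀ v ∈ N, ∑ i, v i ^ 2 = 1) ∧
      ∀ w : Fin d → ℝ, ∑ i, w i ^ 2 = 1 → ∃ v ∈ N, 1 - δ < ∑ i, v i * w i := by
  let S : Set (Fin d → ℝ) := {w | ∑ i, w i ^ 2 = 1}
  have hS : IsCompact S := by
    apply IsCompact.of_isClosed_subset (isCompact_Icc (a := fun _ : Fin d => (-1 : ℝ))
      (b := fun _ => 1))
    · exact isClosed_eq (by fun_prop) (by fun_prop)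
    · intro w hw
      have : ∀ i, |w i| ≤ 1 := by
        intro i
        have h1 : w i ^ 2 ≤ 1 := by
          rw [← (show ∑ i, w i ^ 2 = 1 from hw)]
          exact Finset.single_le_sum (f := fun i => w i ^ 2) (fun i _ => sq_nonneg _)
            (Finset.mem_univ i)
        exact (sq_le_one_iff_abs_le_one _).mp h1
      exact ⟨fun i => (abs_le.mp (this i)).1, fun i => (abs_le.mp (this i)).2⟩
  obtain ⟨t, ht⟩ := hS.elim_finite_subcover
    (fun v : S => {w : Fin d → ℝ | 1 - δ < ∑ i, v.1 i * w i})
    (fun v => isOpen_lt (by fun_prop) (by fun_prop))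
    (by
      intro v hv
      refine Set.mem_iUnion.mpr ⟨⟨v, hv⟩, ?_⟩
      have : ∑ i, v i * v i = 1 := by
        rw [← (show ∑ i, v i ^ 2 = 1 from hv)]
        exact Finset.sum_congr rfl (fun i _ => (sq _).symm)
      simp only [Set.mem_ofPred_eq, this]
      linarith)
  classical
  refine ⟨t.image Subtype.val, ?_, ?_⟩
  · intro v hv
    obtain ⟨u, _, rfl⟩ := Finset.mem_image.mp hv
    exact u.2
  · intro w hw
    have := ht (show w ∈ S from hw)
    simp only [Set.mem_iUnion] at this
    obtain ⟨v, hv, hvw⟩ := this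
    exact ⟨v.1, Finset.mem_image_of_mem _ hv, hvw⟩

/-- Cauchy-Schwarz: disappointment forces a large chi-square distance. -/
lemma cs_aux {X : Type*} {d : ℕ} (ℓ : X → Fin d → ℝ) (a : ℕ → ℝ) (x : X) (P Q : Fin d → ℝ)
    (T : ℕ) (hP : ∑ i, P i = 1) (hQ : Q ∈ simplexInt d) (h : cV a ℓ x Q T < cost ℓ x P) :
    2 * a T / T < ∑ i, (Q i - P i) ^ 2 / Q i := by
  obtain ⟨hpos, hsum⟩ := hQ
  set m := cost ℓ x Q with hm
  have hm' : ∑ i, ℓ x i * Q i = m := rfl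
  have hD : cost ℓ x P - m = ∑ i, (ℓ x i - m) * (P i - Q i) := by
    have e : ∀ i, (ℓ x i - m) * (P i - Q i)
      = ℓ x i * P i - ℓ x i * Q i - m * P i + m * Q i := by intro i; ring
    simp only [e, Finset.sum_add_distrib, Finset.sum_sub_distrib, ← Finset.mul_sum, hsum, hP]
    rw [hm']
    unfold cost
    ring
  have hV : varLoss ℓ x Q = ∑ i, Q i * (ℓ x i - m) ^ 2 := by
    have e : ∀ i, Q i * (ℓ x i - m) ^ 2
      = ℓ x i ^ 2 * Q i - 2 * m * (ℓ x i * Q i) + m ^ 2 * Q i := by intro i; ring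
    simp only [e, Finset.sum_add_distrib, Finset.sum_sub_distrib, ← Finset.mul_sum, hsum]
    rw [hm']
    unfold varLoss
    rw [← hm]
    ring
  have hV0 : 0 ≤ varLoss ℓ x Q := by
    rw [hV]
    exact Finset.sum_nonneg (fun i _ => mul_nonneg (hpos i).le (sq_nonneg _))
  have hCS : (∑ i, (ℓ x i - m) * (P i - Q i)) ^ 2 ≤
      (∑ i, Q i * (ℓ x i - m) ^ 2) * ∑ i, (Q i - P i) ^ 2 / Q i := by
    apply Finset.sum_sq_le_sum_mul_sum_of_sq_eq_mul
    · intro i _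
      exact mul_nonneg (hpos i).le (sq_nonneg _)
    · intro i _
      exact div_nonneg (sq_nonneg _) (hpos i).le
    · intro i _
      have := (hpos i).ne'
      field_simp
      ring
  rw [← hV, ← hD] at hCS
  have h1 : Real.sqrt ((2 * a T / (T : ℝ)) * varLoss ℓ x Q) < cost ℓ x P - m := by
    unfold cV at h
    linarith
  have h2 : 0 < cost ℓ x P - m := lt_of_le_of_lt (Real.sqrt_nonneg _) h1
  rw [Real.sqrt_lt' h2] at h1
  by_contra hcon
  push Not at hcon
  nlinarith [mul_le_mul_of_nonneg_left hcon hV0]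

lemma empDist_sum {d T : ℕ} (hT : 0 < T) (ω : Fin T → Fin d) : ∑ i, empDist ω i = 1 := by
  have hT' : (T : ℝ) ≠ 0 := by exact_mod_cast hT.ne'
  unfold empDist
  rw [← Finset.sum_div, div_eq_one_iff_eq hT']
  have h := Finset.card_eq_sum_card_fiberwise (s := (Finset.univ : Finset (Fin T))) (f := ω)
    (t := Finset.univ) (fun _ _ => Finset.mem_coe.mpr (Finset.mem_univ _))
  rw [Finset.card_univ, Fintype.card_fin] at h
  exact_mod_cast h.symm

/-- If no direction of the net sees a large deviation, the chi-square distance is small. -/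
lemma det_aux {d : ℕ} (P : Fin d → ℝ) (hP : P ∈ simplexInt d) (δ : ℝ) (hδ : 0 < δ)
    (hδ1 : δ < 1) (N : Finset (Fin d → ℝ))
    (hN : ∀ w : Fin d → ℝ, ∑ i, w i ^ 2 = 1 → ∃ v ∈ N, 1 - δ < ∑ i, v i * w i)
    (r : ℝ) (hr : 0 < r) (Q : Fin d → ℝ) (hQ : ∀ i, (1 - δ) * P i ≤ Q i)
    (hbig : r ^ 2 < ∑ i, (Q i - P i) ^ 2 / Q i) :
    ∃ v ∈ N, r * (1 - δ) ^ 2 ≤ ∑ i, v i / Real.sqrt (P i) * (Q i - P i) := by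
  obtain ⟨hpos, hsum⟩ := hP
  have h1δ : 0 < 1 - δ := by linarith
  set R := Real.sqrt (∑ i, (Q i - P i) ^ 2 / P i) with hR
  have hR2 : R ^ 2 = ∑ i, (Q i - P i) ^ 2 / P i := by
    apply Real.sq_sqrt
    exact Finset.sum_nonneg (fun i _ => div_nonneg (sq_nonneg _) (hpos i).le)
  have hlow : (1 - δ) * r ^ 2 < R ^ 2 := by
    refine lt_of_lt_of_le (mul_lt_mul_of_pos_left hbig h1δ) ?_
    rw [hR2, Finset.mul_sum]
    apply Finset.sum_le_sum
    intro i _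
    have hp := hpos i
    have hq : 0 < Q i := lt_of_lt_of_le (mul_pos h1δ hp) (hQ i)
    rw [← mul_div_assoc, div_le_div_iff₀ hq hp]
    nlinarith [mul_le_mul_of_nonneg_left (hQ i) (sq_nonneg (Q i - P i))]
  have hRr : (1 - δ) * r < R := by
    apply lt_of_pow_lt_pow_left₀ 2 (Real.sqrt_nonneg _)
    refine lt_of_le_of_lt ?_ hlow
    nlinarith [mul_pos (mul_pos h1δ hδ) (sq_pos_of_pos hr)]
  have hR0 : 0 < R := lt_trans (mul_pos h1δ hr) hRr
  obtain ⟨v, hv, hvw⟩ := hN (fun i => (Q i - P i) / (Real.sqrt (P i) * R)) (by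
    have : ∀ i, ((Q i - P i) / (Real.sqrt (P i) * R)) ^ 2 = (Q i - P i) ^ 2 / P i / R ^ 2 := by
      intro i
      rw [div_pow, mul_pow, Real.sq_sqrt (hpos i).le, div_div]
    simp only [this]
    rw [← Finset.sum_div, ← hR2]
    field_simp)
  refine ⟨v, hv, ?_⟩
  have e : ∑ i, v i / Real.sqrt (P i) * (Q i - P i)
      = (∑ i, v i * ((Q i - P i) / (Real.sqrt (P i) * R))) * R := by
    rw [Finset.sum_mul]
    apply Finset.sum_congr rfl
    intro i _
    have := (Real.sqrt_pos.mpr (hpos i)).ne'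
    field_simp
  rw [e]
  calc r * (1 - δ) ^ 2 = (1 - δ) * ((1 - δ) * r) := by ring
    _ ≤ (1 - δ) * R := by gcongr
    _ ≤ _ := by gcongr

/-- In the subexponential regime (`a_T → ∞`, `a_T/T → 0`), the SVP predictor together
with any associated argmin prescriptor (defined on `𝒫°`) satisfies the prescription
out-of-sample guarantee. -/
theorem stmt_16 {X : Type*} [MetricSpace X] [CompactSpace X] {d : ℕ}
    (ℓ : X → Fin d → ℝ) (hℓ : ∀ i, Continuous fun x => ℓ x i)
    (a : ℕ → ℝ) (ha_pos : ∀ T, 0 < a T)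
    (ha_top : Tendsto a atTop atTop)
    (ha_sub : Tendsto (fun T : ℕ => a T / (T : ℝ)) atTop (nhds 0))
    (xhat : ℕ → (Fin d → ℝ) → X)
    (hxhat : ∀ (T : ℕ), ∀ P ∈ simplexInt d, ∀ x : X,
      cV a ℓ (xhat T P) P T ≤ cV a ℓ x P T) :
    PrescOOSGuarantee ℓ a (cV a ℓ) xhat := by
  classical
  intro P hP ε hε
  have hpos := hP.1
  have hsum := hP.2
  set δ : ℝ := min (ε / 10) (1 / 2) with hδdef
  have hδ : 0 < δ := by positivity
  have hδε : δ ≤ ε / 10 := min_le_left _ _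
  have hδ1 : δ < 1 := lt_of_le_of_lt (min_le_right _ _) (by norm_num)
  obtain ⟨N, hN1, hN2⟩ := net_aux d δ hδ
  let N1 : Finset (Fin d → ℝ) := N.image (fun v i => v i / Real.sqrt (P i))
  let N2 : Finset (Fin d → ℝ) :=
    Finset.univ.image (fun (k : Fin d) (i : Fin d) => if i = k then (-1 : ℝ) else 0)
  let M := N1 ∪ N2
  have hM : ∀ f ∈ M, ∑ i, P i * f i ^ 2 ≤ 1 := by
    intro f hf
    rcases Finset.mem_union.mp hf with hf | hf
    · obtain ⟨v, hv, rfl⟩ := Finset.mem_image.mp hf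
      rw [← hN1 v hv]
      apply le_of_eq
      apply Finset.sum_congr rfl
      intro i _
      have := (hpos i).ne'
      rw [div_pow, Real.sq_sqrt (hpos i).le]
      field_simp
    · obtain ⟨k, _, rfl⟩ := Finset.mem_image.mp hf
      refine le_trans (Finset.sum_le_sum ?_) hsum.le
      intro i _
      have := hpos i
      dsimp only
      split_ifs
      · norm_num
      · simpa using this.le
  have hr0 : Tendsto (fun T : ℕ => Real.sqrt (2 * a T / (T : ℝ))) atTop (nhds 0) := by
    have h1 : Tendsto (fun T : ℕ => 2 * a T / (T : ℝ)) atTop (nhds 0) := by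
      have := ha_sub.const_mul 2
      simpa [mul_div_assoc] using this
    simpa using h1.sqrt
  have hmgf : ∀ᶠ T : ℕ in atTop, ∀ f ∈ M,
      ∑ i, P i * Real.exp (Real.sqrt (2 * a T / (T : ℝ)) * (f i - ∑ j, f j * P j)) ≤
        Real.exp (Real.sqrt (2 * a T / (T : ℝ)) ^ 2 * (1 + δ) / 2) := by
    rw [Filter.eventually_all_finset]
    intro f hf
    obtain ⟨θ₀, h0, h⟩ := mgf_aux P hP f (hM f hf) δ hδ
    filter_upwards [hr0.eventually_lt_const h0] with T hT
    exact h _ (Real.sqrt_nonneg _) hT.le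
  have hsmall : ∀ᶠ T : ℕ in atTop, ∀ i, Real.sqrt (2 * a T / (T : ℝ)) < δ * P i := by
    rw [Filter.eventually_all]
    intro i
    exact hr0.eventually_lt_const (mul_pos hδ (hpos i))
  have hcard : ∀ᶠ T : ℕ in atTop, 2 / ε * Real.log (M.card + 1) ≤ a T :=
    ha_top.eventually_ge_atTop _
  filter_upwards [hmgf, hsmall, hcard, eventually_gt_atTop 0] with T hT1 hT2 hT3 hT0
  have hT' : (0 : ℝ) < T := by exact_mod_cast hT0
  have haT := ha_pos T
  set r := Real.sqrt (2 * a T / (T : ℝ)) with hrdef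
  have hr : 0 < r := Real.sqrt_pos.mpr (by positivity)
  have hr2 : r ^ 2 = 2 * a T / T := Real.sq_sqrt (by positivity)
  have hTr : T * r ^ 2 = 2 * a T := by rw [hr2]; field_simp
  have hcov := probT_union P hpos T M
    (fun ω => cost ℓ (xhat T (empDist ω)) P > chatStar (cV a ℓ) (empDist ω) T)
    (fun f ω => r * (1 - δ) ^ 2 ≤ ∑ i, f i * (empDist ω i - P i)) (by
      intro ω hω
      by_contra hcon
      push Not at hcon
      have hQ : ∀ i, (1 - δ) * P i ≤ empDist ω i := by
        intro k
        have h1 := hcon (fun i => if i = k then (-1 : ℝ) else 0)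
          (Finset.mem_union_right _ (Finset.mem_image_of_mem _ (Finset.mem_univ k)))
        simp only [ite_mul, zero_mul, Finset.sum_ite_eq', Finset.mem_univ, if_true] at h1
        have h2 := hT2 k
        have h3 : r * (1 - δ) ^ 2 ≤ r := by
          have : (1 - δ) ^ 2 ≤ 1 := by nlinarith
          nlinarith
        linarith
      have hQint : empDist ω ∈ simplexInt d :=
        ⟨fun i => lt_of_lt_of_le (mul_pos (by linarith) (hpos i)) (hQ i), empDist_sum hT0 ω⟩
      have hstar : chatStar (cV a ℓ) (empDist ω) T
          = cV a ℓ (xhat T (empDist ω)) (empDist ω) T := by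
        apply IsLeast.csInf_eq
        refine ⟨⟨_, rfl⟩, ?_⟩
        rintro _ ⟨x, rfl⟩
        exact hxhat T _ hQint x
      rw [hstar] at hω
      have hchi := cs_aux ℓ a _ P _ T hsum hQint hω
      rw [← hr2] at hchi
      obtain ⟨v, hv, hvv⟩ := det_aux P hP δ hδ hδ1 N hN2 r hr _ hQ hchi
      exact absurd hvv (not_le.mpr (hcon (fun i => v i / Real.sqrt (P i))
        (Finset.mem_union_left _
          (Finset.mem_image_of_mem (fun (v : Fin d → ℝ) i => v i / Real.sqrt (P i)) hv)))))
  refine hcov.trans ?_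
  have hterm : ∀ f ∈ M,
      probT P T (fun ω => r * (1 - δ) ^ 2 ≤ ∑ i, f i * (empDist ω i - P i)) ≤
        Real.exp ((-1 + ε / 2) * a T) := by
    intro f hf
    refine (chernoff_aux P hpos f T hT0 r _ hr.le).trans ?_
    have h0 : 0 ≤ ∑ i, P i * Real.exp (r * (f i - ∑ j, f j * P j)) :=
      Finset.sum_nonneg (fun i _ => mul_nonneg (hpos i).le (Real.exp_pos _).le)
    calc _ ≤ Real.exp (-(r * T * (r * (1 - δ) ^ 2))) * Real.exp (r ^ 2 * (1 + δ) / 2) ^ T := by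
          gcongr
          exact hT1 f hf
      _ = Real.exp ((-2 * (1 - δ) ^ 2 + 1 + δ) * a T) := by
          rw [← Real.exp_nat_mul, ← Real.exp_add]
          congr 1
          linear_combination (-(1 - δ) ^ 2 + (1 + δ) / 2) * hTr
      _ ≤ _ := by
          apply Real.exp_le_exp.mpr
          apply mul_le_mul_of_nonneg_right _ haT.le
          nlinarith [sq_nonneg δ]
  refine (Finset.sum_le_sum hterm).trans ?_
  rw [Finset.sum_const, nsmul_eq_mul]
  have hc : (M.card : ℝ) ≤ Real.exp (ε / 2 * a T) := by
    have h1 : Real.log (M.card + 1) ≤ ε / 2 * a T := by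
      have := mul_le_mul_of_nonneg_left hT3 (by positivity : 0 ≤ ε / 2)
      calc Real.log (M.card + 1) = ε / 2 * (2 / ε * Real.log (M.card + 1)) := by field_simp
        _ ≤ _ := this
    have h2 : (M.card : ℝ) + 1 ≤ Real.exp (ε / 2 * a T) :=
      (Real.log_le_iff_le_exp (by positivity)).mp h1
    linarith
  calc (M.card : ℝ) * Real.exp ((-1 + ε / 2) * a T)
      ≤ Real.exp (ε / 2 * a T) * Real.exp ((-1 + ε / 2) * a T) := by gcongr
    _ = Real.exp ((-1 + ε) * a T) := by
        rw [← Real.exp_add]; congr 1; ring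

end DDO
end
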